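/- arXiv:1704.02865 — 4 statements merged into one kernel-verified Lean document; each statement's English description precedes it below -/
import Mathlib

section
/- For every even natural number n, the bi-periodic dual Fibonacci quaternion satisfies the Binet formula: Q̃_n = (1/(ab)^⌊n/2⌋)·(α*·αⁿ − β*·βⁿ)/(α − β) + ε·(1/(ab)^⌊(n+1)/2⌋)·(α**·α^{n+1} − β**·β^{n+1})/(α − β). -/
open Quaternion TrivSqZeroExt

/-- The bi-periodic Fibonacci sequence: `F 0 = 0`, `F 1 = 1`, and
`F n = a * F (n-1) + F (n-2)` if `n` is even, `F n = b * F (n-1) + F (n-2)` if `n` is odd. -/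
noncomputable def biF (a b : ℝ) : ℕ → ℝ
  | 0 => 0
  | 1 => 1
  | n + 2 => (if Even (n + 2) then a else b) * biF a b (n + 1) + biF a b n

/-- The bi-periodic Fibonacci quaternion `Q n = F n + F (n+1) i + F (n+2) j + F (n+3) k`. -/
noncomputable def biQ (a b : ℝ) (n : ℕ) : ℍ[ℝ] :=
  ⟨biF a b n, biF a b (n + 1), biF a b (n + 2), biF a b (n + 3)⟩

/-- The bi-periodic dual Fibonacci quaternion `Q̃ n = Q n + ε * Q (n+1)`,
an element of the dual numbers over the quaternions. -/
noncomputable def biDQ (a b : ℝ) (n : ℕ) : DualNumber ℍ[ℝ] :=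
  inl (biQ a b n) + DualNumber.eps * inl (biQ a b (n + 1))

lemma biF_binet {a b α β : ℝ} (hab : a * b ≠ 0) (hne : α - β ≠ 0)
    (hα : α ^ 2 = a * b * α + a * b) (hβ : β ^ 2 = a * b * β + a * b) (m : ℕ) :
    biF a b (2 * m) = a * (α ^ (2 * m) - β ^ (2 * m)) / ((a * b) ^ m * (α - β)) ∧
      biF a b (2 * m + 1) =
        (α ^ (2 * m + 1) - β ^ (2 * m + 1)) / ((a * b) ^ m * (α - β)) := by
  have ha : a ≠ 0 := left_ne_zero_of_mul hab
  have hb : b ≠ 0 := right_ne_zero_of_mul hab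
  induction m with
  | zero => simp [biF, hne]
  | succ m ih =>
    obtain ⟨he, ho⟩ := ih
    have he' : biF a b (2 * m + 2) =
        a * (α ^ (2 * m + 2) - β ^ (2 * m + 2)) / ((a * b) ^ (m + 1) * (α - β)) := by
      have heven : Even (2 * m + 2) := ⟨m + 1, by ring⟩
      rw [biF, if_pos heven, he, ho, eq_div_iff (by positivity), pow_succ (a * b)]
      field_simp
      linear_combination (-α ^ (2 * m)) * hα + β ^ (2 * m) * hβ
    refine ⟨he', ?_⟩
    have hodd : ¬ Even (2 * m + 1 + 2) := by
      rw [Nat.not_even_iff_odd]; exact ⟨m + 1, by ring⟩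
    rw [show 2 * (m + 1) + 1 = 2 * m + 1 + 2 by ring, biF, if_neg hodd, he', ho,
      eq_div_iff (by positivity), pow_succ (a * b)]
    field_simp
    linear_combination (-α ^ (2 * m + 1)) * hα + β ^ (2 * m + 1) * hβ

/-- Binet formula for the bi-periodic dual Fibonacci quaternions, even index. -/
theorem biDQ_binet_even (a b : ℝ) (hab : 0 < a * b) (α β : ℝ)
    (hα : α = (a * b + Real.sqrt ((a * b) ^ 2 + 4 * (a * b))) / 2)
    (hβ : β = (a * b - Real.sqrt ((a * b) ^ 2 + 4 * (a * b))) / 2)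
    (αs βs αss βss : ℍ[ℝ])
    (hαs : αs = ⟨a, α, a / (a * b) * α ^ 2, 1 / (a * b) * α ^ 3⟩)
    (hβs : βs = ⟨a, β, a / (a * b) * β ^ 2, 1 / (a * b) * β ^ 3⟩)
    (hαss : αss = ⟨1, a / (a * b) * α, 1 / (a * b) * α ^ 2, a / (a * b) ^ 2 * α ^ 3⟩)
    (hβss : βss = ⟨1, a / (a * b) * β, 1 / (a * b) * β ^ 2, a / (a * b) ^ 2 * β ^ 3⟩)
    (n : ℕ) (hn : Even n) :
    biDQ a b n =
      inl ((1 / (a * b) ^ (n / 2) : ℝ) •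
          ((αs * ((α ^ n : ℝ) : ℍ[ℝ]) - βs * ((β ^ n : ℝ) : ℍ[ℝ])) / ((α - β : ℝ) : ℍ[ℝ])))
        + DualNumber.eps *
          inl ((1 / (a * b) ^ ((n + 1) / 2) : ℝ) •
            ((αss * ((α ^ (n + 1) : ℝ) : ℍ[ℝ]) - βss * ((β ^ (n + 1) : ℝ) : ℍ[ℝ])) /
              ((α - β : ℝ) : ℍ[ℝ]))) := by
  have hs := Real.sq_sqrt (show 0 ≤ (a * b) ^ 2 + 4 * (a * b) by positivity)
  have hs0 : 0 < Real.sqrt ((a * b) ^ 2 + 4 * (a * b)) := Real.sqrt_pos.2 (by positivity)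
  have hne : α - β ≠ 0 := by
    rw [hα, hβ]; ring_nf at hs0 ⊢; exact hs0.ne'
  have hα2 : α ^ 2 = a * b * α + a * b := by rw [hα]; linear_combination hs / 4
  have hβ2 : β ^ 2 = a * b * β + a * b := by rw [hβ]; linear_combination hs / 4
  clear hα hβ
  obtain ⟨m, rfl⟩ := even_iff_exists_two_mul.1 hn
  have hF := biF_binet hab.ne' hne hα2 hβ2
  obtain ⟨h0, h1⟩ := hF m
  obtain ⟨h2, h3⟩ := hF (m + 1)
  obtain ⟨h4, -⟩ := hF (m + 2)
  have ha : a ≠ 0 := left_ne_zero_of_mul hab.ne'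
  have hb : b ≠ 0 := right_ne_zero_of_mul hab.ne'
  rw [show 2 * m / 2 = m by omega, show (2 * m + 1) / 2 = m by omega]
  rw [show 2 * (m + 1) = 2 * m + 2 by ring] at h2 h3
  rw [show 2 * (m + 2) = 2 * m + 4 by ring] at h4
  simp only [biDQ, div_eq_mul_inv _ ((α - β : ℝ) : ℍ[ℝ]), ← Quaternion.coe_inv,
    Quaternion.mul_coe_eq_smul]
  congr 3 <;> ext <;>
    simp only [biQ, h0, h1, h2, h3, h4, Quaternion.re_smul, Quaternion.imI_smul,
      Quaternion.imJ_smul, Quaternion.imK_smul, Quaternion.re_sub, Quaternion.imI_sub,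
      Quaternion.imJ_sub, Quaternion.imK_sub, smul_eq_mul] <;>
    simp only [hαs, hβs, hαss, hβss] <;> field_simp <;> ring
end

section
/- Cassini's identity for odd indices: for every natural number m ≥ 1, Q̃_{2m−1}·Q̃_{2m+3} − Q̃_{2m+1}² = −[((ab)² − β⁴)·α**·β** + ((ab)² − α⁴)·β**·α**]/((ab)·(α − β)²) − ε·{ α·[((ab)² − β⁴)·α*·β** + ((ab)² − α⁴)·β**·α*]/((ab)²·(α − β)²) + β·[((ab)² − α⁴)·β*·α** + ((ab)² − β⁴)·α**·β*]/((ab)²·(α − β)²) }. -/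
open Quaternion TrivSqZeroExt

theorem biF_two_mul_add_three (a b : ℝ) (k : ℕ) :
    biF a b (2 * k + 3) = b * biF a b (2 * k + 2) + biF a b (2 * k + 1) := by
  rw [biF, if_neg (by grind)]

theorem biF_two_mul_add_two (a b : ℝ) (k : ℕ) :
    biF a b (2 * k + 2) = a * biF a b (2 * k + 1) + biF a b (2 * k) := by
  rw [biF, if_pos (by grind)]

/-- Even-indexed terms are multiples of `a`, and two consecutive terms lie on a fixed conic. -/
theorem exists_biF_even_eq_mul (a b : ℝ) (k : ℕ) :
    ∃ z, biF a b (2 * k + 2) = a * z ∧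
      biF a b (2 * k + 1) ^ 2 + a * b * biF a b (2 * k + 1) * z - a * b * z ^ 2 = 1 := by
  induction k with
  | zero => exact ⟨1, by simp [biF], by simp [biF]⟩
  | succ k ih =>
    obtain ⟨z, hz, hI⟩ := ih
    have h3 := biF_two_mul_add_three a b k
    have h4 := biF_two_mul_add_two a b (k + 1)
    simp only [Nat.mul_add, Nat.mul_one, Nat.add_assoc, Nat.reduceAdd] at h3 h4 ⊢
    refine ⟨biF a b (2 * k + 3) + z, by rw [h4, hz]; ring, ?_⟩
    rw [h3, hz]
    linear_combination hI

theorem Quaternion.div_coe_eq_smul (q : ℍ[ℝ]) (r : ℝ) : q / (r : ℍ[ℝ]) = r⁻¹ • q := by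
  rw [div_eq_mul_inv, ← Quaternion.coe_inv, Quaternion.mul_coe_eq_smul]

theorem Quaternion.mk_eq_iff {q : ℍ[ℝ]} {r i j k : ℝ} :
    q = ⟨r, i, j, k⟩ ↔ q.re = r ∧ q.imI = i ∧ q.imJ = j ∧ q.imK = k :=
  QuaternionAlgebra.ext_iff

set_option maxHeartbeats 1600000 in
/-- Cassini's identity for the bi-periodic dual Fibonacci quaternions, odd indices. -/
theorem biDQ_cassini_odd (a b : ℝ) (hab : 0 < a * b) (α β : ℝ)
    (hα : α = (a * b + Real.sqrt ((a * b) ^ 2 + 4 * (a * b))) / 2)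
    (hβ : β = (a * b - Real.sqrt ((a * b) ^ 2 + 4 * (a * b))) / 2)
    (αs βs αss βss : ℍ[ℝ])
    (hαs : αs = ⟨a, α, a / (a * b) * α ^ 2, 1 / (a * b) * α ^ 3⟩)
    (hβs : βs = ⟨a, β, a / (a * b) * β ^ 2, 1 / (a * b) * β ^ 3⟩)
    (hαss : αss = ⟨1, a / (a * b) * α, 1 / (a * b) * α ^ 2, a / (a * b) ^ 2 * α ^ 3⟩)
    (hβss : βss = ⟨1, a / (a * b) * β, 1 / (a * b) * β ^ 2, a / (a * b) ^ 2 * β ^ 3⟩)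
    (m : ℕ) (hm : 1 ≤ m) :
    biDQ a b (2 * m - 1) * biDQ a b (2 * m + 3) - (biDQ a b (2 * m + 1)) ^ 2 =
      -inl (((((a * b) ^ 2 - β ^ 4 : ℝ) : ℍ[ℝ]) * (αss * βss)
            + (((a * b) ^ 2 - α ^ 4 : ℝ) : ℍ[ℝ]) * (βss * αss))
          / (((a * b) * (α - β) ^ 2 : ℝ) : ℍ[ℝ]))
        - DualNumber.eps *
          inl (((α : ℝ) : ℍ[ℝ]) *
                (((((a * b) ^ 2 - β ^ 4 : ℝ) : ℍ[ℝ]) * (αs * βss)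
                    + (((a * b) ^ 2 - α ^ 4 : ℝ) : ℍ[ℝ]) * (βss * αs))
                  / (((a * b) ^ 2 * (α - β) ^ 2 : ℝ) : ℍ[ℝ]))
              + ((β : ℝ) : ℍ[ℝ]) *
                (((((a * b) ^ 2 - α ^ 4 : ℝ) : ℍ[ℝ]) * (βs * αss)
                    + (((a * b) ^ 2 - β ^ 4 : ℝ) : ℍ[ℝ]) * (αss * βs))
                  / (((a * b) ^ 2 * (α - β) ^ 2 : ℝ) : ℍ[ℝ]))) := by
  obtain ⟨k, rfl⟩ : ∃ k, m = k + 1 := ⟨m - 1, by omega⟩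
  have h3 := biF_two_mul_add_three a b k
  have h4 := biF_two_mul_add_two a b (k + 1)
  have h5 := biF_two_mul_add_three a b (k + 1)
  have h6 := biF_two_mul_add_two a b (k + 2)
  have h7 := biF_two_mul_add_three a b (k + 2)
  have h8 := biF_two_mul_add_two a b (k + 3)
  have h9 := biF_two_mul_add_three a b (k + 3)
  obtain ⟨z, h2, hI⟩ := exists_biF_even_eq_mul a b k
  have ha : a ≠ 0 := left_ne_zero_of_mul hab.ne'
  have hb : b ≠ 0 := right_ne_zero_of_mul hab.ne'
  have hs : 0 < √((a * b) ^ 2 + 4 * (a * b)) := Real.sqrt_pos.2 (by positivity)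
  have hss : √((a * b) ^ 2 + 4 * (a * b)) ^ 2 = (a * b) ^ 2 + 4 * (a * b) :=
    Real.sq_sqrt (by positivity)
  generalize √((a * b) ^ 2 + 4 * (a * b)) = s at *
  have hαβ : α - β ≠ 0 := by rw [hα, hβ]; ring_nf; exact hs.ne'
  have hsum : α + β = a * b := by rw [hα, hβ]; ring
  have hprod : α * β = -(a * b) := by rw [hα, hβ]; linear_combination -hss / 4
  clear hα hβ hss hs
  obtain ⟨u, rfl⟩ : ∃ u, α = b * u := ⟨α / b, by field_simp⟩
  obtain ⟨v, rfl⟩ : ∃ v, β = b * v := ⟨β / b, by field_simp⟩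
  have huv : u - v ≠ 0 := right_ne_zero_of_mul (mul_sub b u v ▸ hαβ)
  have hsum' : u + v = a := mul_left_cancel₀ hb (by linear_combination hsum)
  have hprod' : b * u * v = -a := mul_left_cancel₀ hb (by linear_combination hprod)
  have hu : b * u ^ 2 = a * (b * u + 1) := by
    linear_combination b * u * hsum' - hprod'
  have hv : b * v ^ 2 = a * (b * v + 1) := by
    linear_combination b * v * hsum' - hprod'
  replace hαs : αs = ⟨a, b * u, a * (b * u + 1), b * u * (b * u + 1)⟩ := by
    rw [hαs]; congr 1 <;> field_simp <;>
      first | linear_combination hu | linear_combination u * hu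
  replace hβs : βs = ⟨a, b * v, a * (b * v + 1), b * v * (b * v + 1)⟩ := by
    rw [hβs]; congr 1 <;> field_simp <;>
      first | linear_combination hv | linear_combination v * hv
  replace hαss : αss = ⟨1, u, b * u + 1, u * (b * u + 1)⟩ := by
    rw [hαss]; congr 1 <;> field_simp <;>
      first | linear_combination hu | linear_combination u * hu
  replace hβss : βss = ⟨1, v, b * v + 1, v * (b * v + 1)⟩ := by
    rw [hβss]; congr 1 <;> field_simp <;>
      first | linear_combination hv | linear_combination v * hv
  rw [Quaternion.mk_eq_iff] at hαs hβs hαss hβss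
  have hcα : (a * b) ^ 2 - (b * u) ^ 4 =
      -(a * b) * (b * u) ^ 2 * (b * u - b * v) := by
    linear_combination (a * b - b * u * (b * v)) * hprod + (b * u) ^ 2 * (b * v - b * u) * hsum
  have hcβ : (a * b) ^ 2 - (b * v) ^ 4 = (a * b) * (b * v) ^ 2 * (b * u - b * v) := by
    linear_combination (a * b - b * u * (b * v)) * hprod + (b * v) ^ 2 * (b * u - b * v) * hsum
  have hQ (n : ℕ) : biQ a b n = ⟨_, _, _, _⟩ := rfl
  simp only [Quaternion.mk_eq_iff] at hQ
  rw [hcα, hcβ]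
  simp only [Nat.mul_add, Nat.mul_one, Nat.add_assoc, Nat.reduceAdd, Nat.reduceMul,
    show 2 * k + 2 - 1 = 2 * k + 1 by omega] at h3 h4 h5 h6 h7 h8 h9 hI ⊢
  simp only [Quaternion.div_coe_eq_smul, Quaternion.coe_mul_eq_smul]
  rw [pow_two]
  ext
  all_goals
    simp [biDQ, hQ, hαs, hβs, hαss, hβss, Nat.add_assoc, -mul_eq_mul_left_iff, -mul_inv_rev]
    simp only [h9, h8, h7, h6, h5, h4, h3, h2]
    generalize biF a b (2 * k + 1) = x at hI ⊢
    rw [← mul_sub b u v]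
    field_simp
    clear * - hI hsum' hprod'
    subst hsum'
    grind
end

section
/- Negative-index symmetry of the bi-periodic Fibonacci sequence: if G : ℤ → ℝ satisfies G(0) = 0, G(1) = 1, and for every integer n, G(n) = a·G(n−1) + G(n−2) when n is even and G(n) = b·G(n−1) + G(n−2) when n is odd, then for every natural number n, G(−n) = (−1)^{n−1}·G(n). -/
/-- If `G : ℤ → ℝ` satisfies the bi-periodic Fibonacci recurrence at every integer index,
with `G 0 = 0` and `G 1 = 1`, then `G (-n) = (-1) ^ (n - 1) * G n` for every natural `n`. -/
theorem biF_neg_index (a b : ℝ) (ha : a ≠ 0) (hb : b ≠ 0) (G : ℤ → ℝ)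
    (hG0 : G 0 = 0) (hG1 : G 1 = 1)
    (heven : ∀ n : ℤ, Even n → G n = a * G (n - 1) + G (n - 2))
    (hodd : ∀ n : ℤ, Odd n → G n = b * G (n - 1) + G (n - 2)) :
    ∀ n : ℕ, G (-(n : ℤ)) = (-1 : ℝ) ^ ((n : ℤ) - 1) * G n := by
  have recurrence (n : ℤ) : ∃ c : ℝ,
      G (n + 2) = c * G (n + 1) + G n ∧ G (-n) = c * G (-(n + 1)) + G (-(n + 2)) := by
    rcases Int.even_or_odd n with h | h
    · refine ⟨a, ?_, ?_⟩
      · convert heven (n + 2) (h.add even_two) using 4 <;> ring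
      · convert heven (-n) h.neg using 4 <;> ring
    · refine ⟨b, ?_, ?_⟩
      · convert hodd (n + 2) (h.add_even even_two) using 4 <;> ring
      · convert hodd (-n) h.neg using 4 <;> ring
  intro n
  rw [zpow_sub_one₀ (by norm_num), zpow_natCast]
  induction n using Nat.twoStepInduction with
  | zero => simp [hG0]
  | one =>
    have h := hodd 1 odd_one
    norm_num [hG0, hG1] at h ⊢
    exact h.symm
  | more n ih₀ ih₁ =>
    obtain ⟨c, hpos, hneg⟩ := recurrence n
    push_cast at ih₁ ⊢
    rw [ih₀, ih₁] at hneg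
    rw [hpos]
    linear_combination -hneg
end

section
/- Binet formula for the dual Fibonacci quaternions (the case a = b = 1): for every natural number n, Q̃_n = (ᾱ·αⁿ − β̄·βⁿ)/(α − β) + ε·(ᾱ·α^{n+1} − β̄·β^{n+1})/(α − β), where α = (1 + √5)/2, β = (1 − √5)/2, ᾱ = 1 + α·i + α²·j + α³·k and β̄ = 1 + β·i + β²·j + β³·k. -/
open Quaternion TrivSqZeroExt

/-- The classical Fibonacci sequence as a real sequence:
`F 0 = 0`, `F 1 = 1`, `F n = F (n-1) + F (n-2)`. -/
noncomputable def fibR : ℕ → ℝ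
  | 0 => 0
  | 1 => 1
  | n + 2 => fibR (n + 1) + fibR n

/-- The Fibonacci quaternion `Q n = F n + F (n+1) i + F (n+2) j + F (n+3) k`. -/
noncomputable def fibQ (n : ℕ) : ℍ[ℝ] :=
  ⟨fibR n, fibR (n + 1), fibR (n + 2), fibR (n + 3)⟩

/-- The dual Fibonacci quaternion `Q̃ n = Q n + ε * Q (n+1)`. -/
noncomputable def fibDQ (n : ℕ) : DualNumber ℍ[ℝ] :=
  inl (fibQ n) + DualNumber.eps * inl (fibQ (n + 1))

theorem fibR_add_two (n : ℕ) : fibR (n + 2) = fibR (n + 1) + fibR n := by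
  rw [fibR]

theorem fibR_eq_coe_fib (n : ℕ) : fibR n = (Nat.fib n : ℝ) := by
  induction n using Nat.twoStepInduction with
  | zero => simp [fibR]
  | one => simp [fibR]
  | more n ih₀ ih₁ => rw [fibR_add_two, ih₀, ih₁, Nat.fib_add_two, Nat.cast_add, add_comm]

theorem fibR_binet (n : ℕ) :
    fibR n = (Real.goldenRatio ^ n - Real.goldenConj ^ n) /
      (Real.goldenRatio - Real.goldenConj) := by
  rw [fibR_eq_coe_fib, Real.coe_fib_eq, Real.goldenRatio_sub_goldenConj]

/-- The quaternion `1 + x i + x ^ 2 j + x ^ 3 k`. -/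
def powQuaternion (x : ℝ) : ℍ[ℝ] :=
  ⟨1, x, x ^ 2, x ^ 3⟩

/-- Binet formula for the Fibonacci quaternions. -/
theorem fibQ_binet (n : ℕ) :
    fibQ n =
      (powQuaternion Real.goldenRatio * ((Real.goldenRatio ^ n : ℝ) : ℍ[ℝ]) -
        powQuaternion Real.goldenConj * ((Real.goldenConj ^ n : ℝ) : ℍ[ℝ])) /
        ((Real.goldenRatio - Real.goldenConj : ℝ) : ℍ[ℝ]) := by
  rw [div_eq_mul_inv, ← Quaternion.coe_inv, Quaternion.mul_coe_eq_smul,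
    Quaternion.mul_coe_eq_smul, Quaternion.mul_coe_eq_smul]
  ext <;> simp only [Quaternion.re_smul, Quaternion.imI_smul,
    Quaternion.imJ_smul, Quaternion.imK_smul, Quaternion.re_sub, Quaternion.imI_sub,
    Quaternion.imJ_sub, Quaternion.imK_sub, smul_eq_mul] <;>
    simp only [fibQ, powQuaternion, fibR_binet] <;> ring

/-- Binet formula for the dual Fibonacci quaternions. -/
theorem fibDQ_binet (α β : ℝ)
    (hα : α = (1 + Real.sqrt 5) / 2) (hβ : β = (1 - Real.sqrt 5) / 2)
    (αb βb : ℍ[ℝ])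
    (hαb : αb = ⟨1, α, α ^ 2, α ^ 3⟩) (hβb : βb = ⟨1, β, β ^ 2, β ^ 3⟩)
    (n : ℕ) :
    fibDQ n =
      inl ((αb * ((α ^ n : ℝ) : ℍ[ℝ]) - βb * ((β ^ n : ℝ) : ℍ[ℝ])) / ((α - β : ℝ) : ℍ[ℝ]))
        + DualNumber.eps *
          inl ((αb * ((α ^ (n + 1) : ℝ) : ℍ[ℝ]) - βb * ((β ^ (n + 1) : ℝ) : ℍ[ℝ])) /
            ((α - β : ℝ) : ℍ[ℝ])) := by
  obtain rfl : α = Real.goldenRatio := hα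
  obtain rfl : β = Real.goldenConj := hβ
  obtain rfl : αb = powQuaternion Real.goldenRatio := hαb
  obtain rfl : βb = powQuaternion Real.goldenConj := hβb
  rw [fibDQ, fibQ_binet, fibQ_binet]
end
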